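/- arXiv:2511.22122 — 3 statements merged into one kernel-verified Lean document; each statement's English description precedes it below -/
import Mathlib

section
/- Let D be a probability distribution on [N], let τ ∈ (0,1], let c > 0, and let B = {x ∈ [N] : c < D(x) ≤ c·(1+τ)} be a bucket (a set of elements whose probabilities lie within a multiplicative factor 1+τ of each other), with total mass p := D(B). If B is nonempty, then there exists y ∈ B such that D(U_{τ/3}(y)) ≥ p/3, where U_{τ/3}(y) = {x ∈ [N] : D(y)/(1+τ/3) ≤ D(x) ≤ (1+τ/3)·D(y)} is the (τ/3)-neighbourhood of y under D. (Claim 4.6 of the paper.) -/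
open Finset

/-- A set on which `D` varies by a factor of at most `1 + t` lies in the `t`-neighbourhood of each
of its points. -/
lemma sum_le_sum_neighbourhood {ι : Type*} [Fintype ι] {D : ι → ℝ} (hD : ∀ x, 0 ≤ D x) {t : ℝ}
    (ht : 0 < t) {S : Finset ι} (hS : ∀ x ∈ S, ∀ y ∈ S, D x ≤ (1 + t) * D y) {y : ι} (hy : y ∈ S) :
    ∑ x ∈ S, D x ≤
      ∑ x ∈ univ.filter (fun x => D y / (1 + t) ≤ D x ∧ D x ≤ (1 + t) * D y), D x := by
  refine sum_le_sum_of_subset_of_nonneg (fun x hx => ?_) fun x _ _ => hD x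
  refine mem_filter.2 ⟨mem_univ x, ?_, hS x hx y hy⟩
  rw [div_le_iff₀ (by linarith), mul_comm]
  exact hS y hy x hx

/-- Claim 4.6: every bucket of total mass `p` contains a point whose
`τ/3`-neighbourhood has mass at least `p/3`. -/
theorem bucket_has_heavy_neighbourhood
    (N : ℕ) (D : Fin N → ℝ) (hD0 : ∀ x, 0 ≤ D x) (hD1 : ∑ x, D x = 1)
    (τ : ℝ) (hτ0 : 0 < τ) (hτ1 : τ ≤ 1)
    (c : ℝ) (hc : 0 < c)
    (B : Finset (Fin N))
    (hB : B = univ.filter (fun x => c < D x ∧ D x ≤ c * (1 + τ)))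
    (p : ℝ) (hp : p = ∑ x ∈ B, D x)
    (hBne : B.Nonempty) :
    ∃ y ∈ B,
      p / 3 ≤
        ∑ x ∈ univ.filter
          (fun x => D y / (1 + τ / 3) ≤ D x ∧ D x ≤ (1 + τ / 3) * D y), D x := by
  have hBmem : ∀ x ∈ B, c < D x ∧ D x ≤ c * (1 + τ) := fun x hx => by
    rw [hB] at hx
    exact (mem_filter.1 hx).2
  have hp_pos : 0 < p := hp ▸ sum_pos (fun x hx => hc.trans (hBmem x hx).1) hBne
  by_contra! h
  have light : ∀ S ⊆ B, (∀ x ∈ S, ∀ y ∈ S, D x ≤ (1 + τ / 3) * D y) →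
      ∑ x ∈ S, D x < p / 3 := by
    intro S hSB hS
    rcases S.eq_empty_or_nonempty with rfl | ⟨y, hy⟩
    · simpa using hp_pos
    · exact (sum_le_sum_neighbourhood hD0 (by positivity) hS hy).trans_lt (h y (hSB hy))
  have interval : ∀ a b : ℝ, b ≤ (1 + τ / 3) * a → ∀ x y : Fin N,
      D x ≤ b → a < D y → D x ≤ (1 + τ / 3) * D y := by
    intro a b hab x y hx hy
    have : (1 + τ / 3) * a ≤ (1 + τ / 3) * D y := by gcongr
    linarith
  have hcτ : 0 < c * τ := by positivity
  have hcτ2 : 0 < c * τ * τ := by positivity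
  have low := light (B.filter fun x => D x ≤ c * (1 + τ / 3)) (filter_subset _ _) <| by
    intro x hx y hy
    rw [mem_filter] at hx hy
    exact interval c (c * (1 + τ / 3)) (by linarith) x y hx.2 (hBmem y hy.1).1
  have mid := light ((B.filter fun x => ¬ D x ≤ c * (1 + τ / 3)).filter
      fun x => D x ≤ c * (1 + 2 * τ / 3))
      ((filter_subset _ _).trans (filter_subset _ _)) <| by
    intro x hx y hy
    simp only [mem_filter, not_le] at hx hy
    exact interval (c * (1 + τ / 3)) (c * (1 + 2 * τ / 3)) (by nlinarith) x y
      hx.2 hy.1.2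
  have high := light ((B.filter fun x => ¬ D x ≤ c * (1 + τ / 3)).filter
      fun x => ¬ D x ≤ c * (1 + 2 * τ / 3))
      ((filter_subset _ _).trans (filter_subset _ _)) <| by
    intro x hx y hy
    simp only [mem_filter, not_le] at hx hy
    exact interval (c * (1 + 2 * τ / 3)) (c * (1 + τ)) (by nlinarith) x y
      (hBmem x hx.1.1).2 hy.2
  have split_low := sum_filter_add_sum_filter_not B (fun x => D x ≤ c * (1 + τ / 3)) D
  have split_high := sum_filter_add_sum_filter_not (B.filter fun x => ¬ D x ≤ c * (1 + τ / 3))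
    (fun x => D x ≤ c * (1 + 2 * τ / 3)) D
  linarith
end

section
/- For every real number c with 0 ≤ c ≤ 1, one has (1 − c + 2c²) − (1 + c²)·e^{−c} ≥ c²/2. (The gap between the rejection probabilities in the soundness and completeness cases of Claim 4.2, Test 1 of the support-size protocol.) -/
theorem Real.exp_neg_le_quadratic {x : ℝ} (hx : 0 ≤ x) :
    Real.exp (-x) ≤ 1 - x + x ^ 2 / 2 := by
  rw [Real.exp_neg, inv_le_iff_one_le_mul₀ (Real.exp_pos x)]
  calc (1 : ℝ) ≤ (1 - x + x ^ 2 / 2) * (1 + x + x ^ 2 / 2) := by nlinarith [sq_nonneg (x ^ 2)]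
    _ ≤ (1 - x + x ^ 2 / 2) * Real.exp x :=
      mul_le_mul_of_nonneg_left (Real.quadratic_le_exp_of_nonneg hx)
        (by nlinarith [sq_nonneg (x - 1)])

/-- Gap between the rejection probabilities in Claim 4.2 (Test 1):
`(1 − c + 2c²) − (1 + c²)·e^{−c} ≥ c²/2` for `0 ≤ c ≤ 1`. -/
theorem test1_rejection_gap (c : ℝ) (hc0 : 0 ≤ c) (hc1 : c ≤ 1) :
    (1 - c + 2 * c ^ 2) - (1 + c ^ 2) * Real.exp (-c) ≥ c ^ 2 / 2 := by
  have hexp : (1 + c ^ 2) * Real.exp (-c) ≤ (1 + c ^ 2) * (1 - c + c ^ 2 / 2) :=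
    mul_le_mul_of_nonneg_left (Real.exp_neg_le_quadratic hc0) (by positivity)
  have hcube : 0 ≤ c ^ 3 * (2 - c) := mul_nonneg (by positivity) (by linarith)
  linarith
end

section
/- Let s be a natural number, p ∈ [0,1], and μ ≥ 0 with s·p ≤ μ. Let X be a Binomial(s, p) random variable. Then (1/2)·P(X = 1) + P(X ≥ 2) ≤ μ/2 + μ²/2. (The completeness rejection-probability bound in Claim 4.3, Test 2 of the support-size protocol.) -/
open Finset

/-- The mean of a binomial distribution, as a polynomial identity in `p`. -/
theorem sum_range_mul_choose_mul_pow_mul_one_sub_pow (s : ℕ) (p : ℝ) :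
    ∑ k ∈ range (s + 1), (k : ℝ) * ((s.choose k : ℝ) * p ^ k * (1 - p) ^ (s - k)) = s * p := by
  have h := congrArg (Polynomial.eval p) (bernsteinPolynomial.sum_smul ℝ s)
  simpa [bernsteinPolynomial, Polynomial.eval_finsetSum] using h

/-- Completeness rejection-probability bound in Claim 4.3 (Test 2): for a
`Binomial(s,p)` random variable `X` with `s·p ≤ μ`,
`(1/2)·P(X = 1) + P(X ≥ 2) ≤ μ/2 + μ²/2`. -/
theorem binomial_rejection_bound (s : ℕ) (p μ : ℝ)
    (hp0 : 0 ≤ p) (hp1 : p ≤ 1) (hμ : 0 ≤ μ) (hsp : (s : ℝ) * p ≤ μ) :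
    (1 / 2) * ((s : ℝ) * p * (1 - p) ^ (s - 1))
      + ∑ k ∈ Finset.Icc 2 s, (s.choose k : ℝ) * p ^ k * (1 - p) ^ (s - k)
      ≤ μ / 2 + μ ^ 2 / 2 := by
  rcases Nat.eq_zero_or_pos s with rfl | hs
  · simp only [Nat.cast_zero, zero_mul, mul_zero, zero_add]
    simp only [show Icc 2 0 = ∅ from rfl, sum_empty]
    positivity
  have hmean := sum_range_mul_choose_mul_pow_mul_one_sub_pow s p
  rw [range_eq_Ico, sum_eq_sum_Ico_succ_bot (by lia), sum_eq_sum_Ico_succ_bot (by lia),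
    show Ico (0 + 1 + 1) (s + 1) = Icc 2 s by ext; simp only [mem_Ico, mem_Icc]; lia] at hmean
  simp only [Nat.cast_zero, zero_mul, zero_add, Nat.cast_one, one_mul, Nat.choose_one_right,
    pow_one] at hmean
  have htail : ∑ k ∈ Icc 2 s, (s.choose k : ℝ) * p ^ k * (1 - p) ^ (s - k) ≤
      (1 / 2) * ∑ k ∈ Icc 2 s, (k : ℝ) * ((s.choose k : ℝ) * p ^ k * (1 - p) ^ (s - k)) := by
    rw [mul_sum]
    refine sum_le_sum fun k hk => ?_
    have hk2 : (2 : ℝ) ≤ k := by exact_mod_cast (mem_Icc.mp hk).1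
    have hq : 0 ≤ 1 - p := sub_nonneg.mpr hp1
    have hb : 0 ≤ (s.choose k : ℝ) * p ^ k * (1 - p) ^ (s - k) := by positivity
    nlinarith
  nlinarith [sq_nonneg μ]
end
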